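/- For any complete dictionary D, any n ≥ 1, and any type class T ∈ T_n, there is a one-to-one correspondence between the set tree_D(T) of sequences of T that correspond to nodes of the tree of D, and the disjoint union over a ∈ A of fail_{n−1}(T_a(T)); consequently |fail_n(T)| = Σ_{a∈A} |fail_{n−1}(T_a(T))| − |D(T)|, with the convention fail_{n−1}(∅) = ∅. -/

import Mathlib

open Finset

/-- `Finset.filter` with classical decidability. -/
noncomputable def sfilter {α : Type*} (p : α → Prop) (s : Finset α) : Finset α :=
  @Finset.filter α p (Classical.decPred p) s

/-- The finset of all strings of length `n` over the alphabet `A`. -/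
def lists (A : Type*) [Fintype A] [DecidableEq A] : ℕ → Finset (List A)
  | 0 => {[]}
  | n + 1 => Finset.image₂ List.cons Finset.univ (lists A n)

/-- Symbol at (0-indexed) integer position `j` of the string `x`, where negative
positions `-k, …, -1` are given by the fixed initial state `s0`. -/
def symL {A : Type*} [Inhabited A] (k : ℕ) (s0 : Fin k → A) (x : List A) (j : ℤ) : A :=
  if h : 0 ≤ j then
    (if h2 : j.toNat < x.length then x.get ⟨j.toNat, h2⟩ else default)
  else
    (if h3 : (j + k).toNat < k then s0 ⟨(j + k).toNat, h3⟩ else default)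

/-- The state (context of order `k`) preceding position `t` of the string `x`. -/
def ctxL {A : Type*} [Inhabited A] (k : ℕ) (s0 : Fin k → A) (x : List A)
    (t : ℕ) : Fin k → A :=
  fun i => symL k s0 x ((t : ℤ) - (k : ℤ) + (i : ℤ))

/-- `n_{sa}(x)`: number of occurrences of symbol `a` in state `s` within `x`. -/
noncomputable def countL {A : Type*} [Inhabited A] [DecidableEq A] (k : ℕ)
    (s0 : Fin k → A) (s : Fin k → A) (a : A) (x : List A) : ℕ :=
  (sfilter (fun t : Fin x.length => ctxL k s0 x t = s ∧ x.get t = a) Finset.univ).card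

/-- Two strings have the same `k`-th order type. -/
def sameTypeL {A : Type*} [Inhabited A] [DecidableEq A] (k : ℕ) (s0 : Fin k → A)
    (x y : List A) : Prop :=
  x.length = y.length ∧
    ∀ (s : Fin k → A) (a : A), countL k s0 s a x = countL k s0 s a y

/-- The type class `T(x)` as a finset of strings of length `|x|`. -/
noncomputable def typeClassL {A : Type*} [Fintype A] [DecidableEq A] [Inhabited A]
    (k : ℕ) (s0 : Fin k → A) (x : List A) : Finset (List A) :=
  sfilter (fun y => sameTypeL k s0 x y) (lists A x.length)

/-- Probability `P(x) = ∏_t p(x_t | state)` of the string `x`. -/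
noncomputable def seqProbL {A : Type*} [Inhabited A] (k : ℕ) (s0 : Fin k → A)
    (p : (Fin k → A) → A → ℝ) (x : List A) : ℝ :=
  ∏ t : Fin x.length, p (ctxL k s0 x t) (x.get t)

/-- `p` is a (strictly positive) `k`-th order Markov kernel. -/
def IsMarkov {A : Type*} [Fintype A] (k : ℕ) (p : (Fin k → A) → A → ℝ) : Prop :=
  (∀ s a, 0 < p s a) ∧ ∀ s, ∑ a : A, p s a = 1

/-- A prefix-free set of strings. -/
def PrefixFree {A : Type*} (D : Set (List A)) : Prop :=
  ∀ x ∈ D, ∀ y ∈ D, x <+: y → x = y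

/-- A complete dictionary: prefix-free, and every string either has a prefix in `D`
or is a prefix of a string in `D`. -/
def CompleteDict {A : Type*} (D : Set (List A)) : Prop :=
  PrefixFree D ∧ ∀ z : List A, (∃ x ∈ D, x <+: z) ∨ (∃ y ∈ D, z <+: y)

/-- `D ∩ A^n` as a finset. -/
noncomputable def dictAt {A : Type*} [Fintype A] [DecidableEq A]
    (D : Set (List A)) (n : ℕ) : Finset (List A) :=
  sfilter (fun x => x ∈ D) (lists A n)

/-- The failure set at level `n`: strings of length `n` with no prefix in `D`. -/
noncomputable def failAt {A : Type*} [Fintype A] [DecidableEq A]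
    (D : Set (List A)) (n : ℕ) : Finset (List A) :=
  sfilter (fun x => ¬ ∃ y ∈ D, y <+: x) (lists A n)

/-- The failure part of a finite set `T` of strings: members with no prefix in `D`. -/
noncomputable def failIn {A : Type*} (D : Set (List A)) (T : Finset (List A)) :
    Finset (List A) :=
  sfilter (fun x => ¬ ∃ y ∈ D, y <+: x) T

/-- The VFR `(D, ξ, M)` is perfect for the process `p` (at every level `n`,
equivalently at every truncation level): conditioned on `X^n ∈ D ∩ A^n`
(whenever nonempty), `ξ(X^n)` is uniform on `{0, …, M−1}`. -/
def PerfectVFR {A : Type*} [Fintype A] [DecidableEq A] [Inhabited A] (k : ℕ)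
    (s0 : Fin k → A) (p : (Fin k → A) → A → ℝ) (D : Set (List A))
    (ξ : List A → ℕ) (M : ℕ) : Prop :=
  ∀ n : ℕ, (dictAt (A := A) D n).Nonempty →
    ∀ r < M,
      (∑ x ∈ sfilter (fun x => ξ x = r) (dictAt (A := A) D n), seqProbL k s0 p x)
        = (∑ x ∈ dictAt (A := A) D n, seqProbL k s0 p x) / (M : ℝ)

/-- `T_u(T)`: the prefixes of length `n − ℓ` of the members `z` of `T` (strings of
length `n`) whose symbols at positions `n−k−ℓ+1, …, n−k` (1-indexed, with the
initial-state convention for nonpositive indices) form the string `u` (of length `ℓ`). -/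
noncomputable def TcutSet {A : Type*} [DecidableEq A] [Inhabited A] (k : ℕ) (s0 : Fin k → A)
    (T : Finset (List A)) (u : List A) : Finset (List A) :=
  Finset.image (fun z => z.take (z.length - u.length))
    (sfilter (fun z => u.length ≤ z.length ∧
      ∀ i : Fin u.length,
        symL k s0 z ((z.length : ℤ) - (k : ℤ) - (u.length : ℤ) + (i : ℤ)) = u.get i) T)

/-- The members of `T` that are nodes of the tree of `D`, i.e. prefixes of strings
of `D`. -/
noncomputable def treeIn {A : Type*} (D : Set (List A)) (T : Finset (List A)) :
    Finset (List A) :=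
  sfilter (fun y => ∃ z ∈ D, y <+: z) T

theorem mem_sfilter {α : Type*} {p : α → Prop} {s : Finset α} {x : α} :
    x ∈ sfilter p s ↔ x ∈ s ∧ p x := by
  classical
  simp [sfilter]

/-- Symbols strictly before the last position do not depend on the last symbol. -/
theorem symL_append_singleton {A : Type*} [Inhabited A] (k : ℕ) (s0 : Fin k → A)
    (w : List A) (b : A) {j : ℤ} (hj : j < w.length) :
    symL k s0 (w ++ [b]) j = symL k s0 w j := by
  unfold symL
  split_ifs with h h1 h2 h3
  · simp [List.getElem_append_left h2]
  · omega
  · simp at h1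
    omega
  · rfl
  · rfl
  · rfl

theorem ctxL_append_singleton {A : Type*} [Inhabited A] (k : ℕ) (s0 : Fin k → A)
    (w : List A) (b : A) {t : ℕ} (ht : t ≤ w.length) :
    ctxL k s0 (w ++ [b]) t = ctxL k s0 w t := by
  funext i
  have := i.isLt
  exact symL_append_singleton k s0 w b (by omega)

open Classical in
theorem countL_eq_card_range {A : Type*} [Inhabited A] [DecidableEq A] (k : ℕ)
    (s0 s : Fin k → A) (a : A) (x : List A) :
    countL k s0 s a x
      = ((range x.length).filter fun t => ctxL k s0 x t = s ∧ x[t]? = some a).card := by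
  refine Finset.card_bij (fun t _ => (t : ℕ)) ?_ ?_ ?_
  · intro t ht
    have h := (mem_sfilter.1 ht).2
    simpa using h
  · intro t _ t' _ h
    exact Fin.ext h
  · intro t ht
    obtain ⟨h, h1, h2⟩ := by simpa using ht
    refine ⟨⟨t, h⟩, mem_sfilter.2 ⟨mem_univ _, h1, ?_⟩, rfl⟩
    simpa [List.getElem?_eq_getElem h] using h2

open Classical in
theorem countL_append_singleton {A : Type*} [Inhabited A] [DecidableEq A] (k : ℕ)
    (s0 s : Fin k → A) (a b : A) (w : List A) :
    countL k s0 s a (w ++ [b])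
      = countL k s0 s a w + if ctxL k s0 w w.length = s ∧ b = a then 1 else 0 := by
  have hlt : ((range w.length).filter
        fun t => ctxL k s0 (w ++ [b]) t = s ∧ (w ++ [b])[t]? = some a)
      = (range w.length).filter fun t => ctxL k s0 w t = s ∧ w[t]? = some a := by
    refine filter_congr fun t ht => ?_
    have ht := mem_range.1 ht
    rw [ctxL_append_singleton k s0 w b ht.le, List.getElem?_append_left ht]
  rw [countL_eq_card_range, countL_eq_card_range, List.length_append, List.length_singleton,
    range_add_one, filter_insert, hlt, ctxL_append_singleton k s0 w b le_rfl,
    List.getElem?_concat_length]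
  simp only [Option.some.injEq]
  split_ifs with h
  · rw [card_insert_of_notMem (by simp)]
  · rfl

/-- Two strings of the same type that agree except possibly in the last symbol are equal. -/
theorem eq_of_sameTypeL_of_dropLast_eq {A : Type*} [Inhabited A] [DecidableEq A] {k : ℕ}
    {s0 : Fin k → A} {y z : List A} (h : sameTypeL k s0 y z)
    (hd : y.dropLast = z.dropLast) : y = z := by
  rcases List.eq_nil_or_concat' y with rfl | ⟨w, b, rfl⟩
  · exact (List.length_eq_zero_iff.1 h.1.symm).symm
  rcases List.eq_nil_or_concat' z with rfl | ⟨v, c, rfl⟩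
  · exact List.length_eq_zero_iff.1 h.1
  obtain rfl : w = v := by simpa using hd
  have hc := h.2 (ctxL k s0 w w.length) b
  rw [countL_append_singleton, countL_append_singleton] at hc
  by_cases hcb : c = b
  · rw [hcb]
  · simp [hcb] at hc

theorem dropLast_injOn_typeClassL {A : Type*} [Fintype A] [DecidableEq A] [Inhabited A]
    (k : ℕ) (s0 : Fin k → A) (x : List A) :
    Set.InjOn List.dropLast (typeClassL k s0 x : Set (List A)) := by
  intro y hy z hz h
  have hy := (mem_sfilter.1 (mem_coe.1 hy)).2
  have hz := (mem_sfilter.1 (mem_coe.1 hz)).2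
  exact eq_of_sameTypeL_of_dropLast_eq
    ⟨hy.1.symm.trans hz.1, fun s a => (hy.2 s a).symm.trans (hz.2 s a)⟩ h

/-- A nonempty string is a node of the tree of a complete dictionary iff its parent has no
prefix in the dictionary. -/
theorem CompleteDict.exists_prefix_iff_dropLast {A : Type*} {D : Set (List A)}
    (hD : CompleteDict D) {y : List A} (hy : y ≠ []) :
    (∃ z ∈ D, y <+: z) ↔ ¬ ∃ z ∈ D, z <+: y.dropLast := by
  constructor
  · rintro ⟨z, hz, hyz⟩ ⟨v, hv, hvy⟩
    obtain rfl := hD.1 v hv z hz ((hvy.trans y.dropLast_prefix).trans hyz)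
    have h := (hyz.trans hvy).length_le
    have := List.length_pos_iff.2 hy
    rw [List.length_dropLast] at h
    omega
  · intro h
    rcases hD.2 y with ⟨v, hv, hvy⟩ | h'
    · rw [← List.dropLast_append_getLast hy, List.prefix_concat_iff,
        List.dropLast_append_getLast hy] at hvy
      rcases hvy with rfl | hvy
      · exact ⟨v, hv, List.prefix_rfl⟩
      · exact absurd ⟨v, hv, hvy⟩ h
    · exact h'

/-- A string is a node of the tree of a complete dictionary iff it has no prefix in the
dictionary or is itself a word of the dictionary. -/
theorem CompleteDict.exists_prefix_iff_or_mem {A : Type*} {D : Set (List A)}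
    (hD : CompleteDict D) (y : List A) :
    (∃ z ∈ D, y <+: z) ↔ (¬ ∃ z ∈ D, z <+: y) ∨ y ∈ D := by
  constructor
  · rintro ⟨z, hz, hyz⟩
    refine or_iff_not_imp_left.2 fun h => ?_
    obtain ⟨v, hv, hvy⟩ := not_not.1 h
    obtain rfl := hD.1 v hv z hz (hvy.trans hyz)
    rwa [hyz.eq_of_length_le hvy.length_le]
  · rintro (h | h)
    · exact (hD.2 y).resolve_left h
    · exact ⟨y, h, List.prefix_rfl⟩

theorem CompleteDict.card_treeIn {A : Type*} {D : Set (List A)}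
    (hD : CompleteDict D) (T : Finset (List A)) :
    (treeIn D T).card = (failIn D T).card + (sfilter (fun y => y ∈ D) T).card := by
  classical
  rw [← card_union_of_disjoint]
  · congr 1
    ext y
    simp only [treeIn, failIn, mem_union, mem_sfilter, hD.exists_prefix_iff_or_mem y, and_or_left]
  · refine disjoint_left.2 fun y hy hy' => ?_
    exact (mem_sfilter.1 hy).2 ⟨y, (mem_sfilter.1 hy').2, List.prefix_rfl⟩

theorem mem_TcutSet_singleton {A : Type*} [DecidableEq A] [Inhabited A] {k : ℕ}
    {s0 : Fin k → A} {T : Finset (List A)} {a : A} {w : List A} :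
    w ∈ TcutSet k s0 T [a] ↔ ∃ z ∈ T, z ≠ [] ∧
      symL k s0 z ((z.length : ℤ) - k - 1) = a ∧ z.dropLast = w := by
  simp only [TcutSet, mem_image, mem_sfilter, List.length_singleton, ← List.dropLast_eq_take,
    Nat.one_le_iff_ne_zero, ne_eq, List.length_eq_zero_iff]
  simp [and_assoc]

/-- Deleting the last symbol, and recording the symbol that leaves the final state, partitions
the tree nodes of a set on which `List.dropLast` is injective. -/
theorem CompleteDict.card_treeIn_eq_sum {A : Type*} [Fintype A] [DecidableEq A] [Inhabited A]
    {D : Set (List A)} (hD : CompleteDict D) (k : ℕ) (s0 : Fin k → A) {T : Finset (List A)}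
    (hT : ∀ z ∈ T, z ≠ []) (hinj : Set.InjOn List.dropLast (T : Set (List A))) :
    (treeIn D T).card = ∑ a : A, (failIn D (TcutSet k s0 T [a])).card := by
  classical
  rw [card_eq_sum_card_fiberwise (t := univ)
    (f := fun z => symL k s0 z ((z.length : ℤ) - k - 1)) (fun _ _ => mem_coe.2 (mem_univ _))]
  refine sum_congr rfl fun a _ => card_bij (fun z _ => z.dropLast) ?_ ?_ ?_
  · intro z hz
    obtain ⟨hz, ha⟩ := mem_filter.1 hz
    obtain ⟨hz, hd⟩ := mem_sfilter.1 hz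
    exact mem_sfilter.2 ⟨mem_TcutSet_singleton.2 ⟨z, hz, hT z hz, ha, rfl⟩,
      (hD.exists_prefix_iff_dropLast (hT z hz)).1 hd⟩
  · intro z hz z' hz' h
    exact hinj (mem_sfilter.1 (mem_filter.1 hz).1).1 (mem_sfilter.1 (mem_filter.1 hz').1).1 h
  · intro w hw
    obtain ⟨hw, hd⟩ := mem_sfilter.1 hw
    obtain ⟨z, hz, hne, ha, rfl⟩ := mem_TcutSet_singleton.1 hw
    exact ⟨z, mem_filter.2 ⟨mem_sfilter.2 ⟨hz, (hD.exists_prefix_iff_dropLast hne).2 hd⟩, ha⟩, rfl⟩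

/-- For a complete dictionary `D` and a type class `T` of length
`n ≥ 1`, the nodes of the tree of `D` lying in `T` are in one-to-one correspondence
with the disjoint union over `a ∈ A` of the failure sets `fail_{n−1}(T_a(T))`;
consequently `|fail_n(T)| + |D(T)| = Σ_a |fail_{n−1}(T_a(T))|`. -/
theorem tree_nodes_bijection_card {A : Type*} [Fintype A] [DecidableEq A] [Inhabited A]
    (hA : 2 ≤ Fintype.card A) (k : ℕ) (s0 : Fin k → A)
    (D : Set (List A)) (hD : CompleteDict D)
    (x : List A) (hx : 1 ≤ x.length) :
    (treeIn D (typeClassL k s0 x)).card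
        = (∑ a : A, (failIn D (TcutSet k s0 (typeClassL k s0 x) [a])).card) ∧
    (failIn D (typeClassL k s0 x)).card
        + (sfilter (fun y => y ∈ D) (typeClassL k s0 x)).card
      = ∑ a : A, (failIn D (TcutSet k s0 (typeClassL k s0 x) [a])).card := by
  have hne : ∀ z ∈ typeClassL k s0 x, z ≠ [] := by
    rintro z hz rfl
    have h := (mem_sfilter.1 hz).2.1
    rw [h] at hx
    exact absurd hx (by simp)
  have h := hD.card_treeIn_eq_sum k s0 hne (dropLast_injOn_typeClassL k s0 x)
  exact ⟨h, (hD.card_treeIn _).symm.trans h⟩
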